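/- Let T be a meet-tree, Γ a semibranch with projection π_Γ, and x, y ∈ T. Then π_Γ(x ⊓ y) = π_Γ(x) ⊓ π_Γ(y) = π_Γ(x) ⊓ y = min{π_Γ(x), π_Γ(y)}. -/

import Mathlib

/-- For a semibranch `Γ` of a meet-tree with projection `π`, we have
`π (x ⊓ y) = π x ⊓ π y = π x ⊓ y`, and `π x ⊓ π y` is `min {π x, π y}`
(since `π x` and `π y` are comparable). -/
theorem semibranch_proj_inf {T : Type*} [SemilatticeInf T]
    (hsl : ∀ a : T, IsChain (· ≤ ·) {x : T | x < a})
    (Γ : Set T) (hchain : IsChain (· ≤ ·) Γ)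
    (hdc : ∀ ⦃x y : T⦄, x ≤ y → y ∈ Γ → x ∈ Γ)
    (π : T → T) (hπ : ∀ a : T, IsGreatest {c | c ∈ Γ ∧ c ≤ a} (π a))
    (x y : T) :
    π (x ⊓ y) = π x ⊓ π y ∧ π (x ⊓ y) = π x ⊓ y ∧
      (π x ⊓ π y = π x ∨ π x ⊓ π y = π y) := by
  have hmem (a : T) : π a ∈ Γ := (hπ a).1.1
  have hle (a : T) : π a ≤ a := (hπ a).1.2
  have hmax {a c : T} (hc : c ∈ Γ) (hca : c ≤ a) : c ≤ π a := (hπ a).2 ⟨hc, hca⟩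
  have hlx : π (x ⊓ y) ≤ π x := hmax (hmem _) ((hle _).trans inf_le_left)
  have hly : π (x ⊓ y) ≤ π y := hmax (hmem _) ((hle _).trans inf_le_right)
  refine ⟨le_antisymm (le_inf hlx hly) ?_, le_antisymm (le_inf hlx (hly.trans (hle y))) ?_, ?_⟩
  · exact hmax (hdc inf_le_left (hmem x)) (inf_le_inf (hle x) (hle y))
  · exact hmax (hdc inf_le_left (hmem x)) (inf_le_inf_right y (hle x))
  · exact (hchain.total (hmem x) (hmem y)).imp inf_eq_left.mpr inf_eq_right.mpr
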